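/- In the situation of the polar-genericity lemma, assume in addition that r − 1 ≥ c(d̲) and q − 1 = q(d̲), where c(d̲) and q(d̲) are the constants of the Morin–Predonzan–Ciliberto theorem for the multidegree d̲ = (1,2,…,2d−2). That is: K' is a field of characteristic zero, d ≥ 3, 2d−2 ≤ q < r, G = Σ_{|I|<2d} b_{I,J} Z^I Y^J is homogeneous of degree 2d in Z_0,…,Z_q,Y_{q+1},…,Y_r with every monomial involving a Y-variable and all coefficients algebraically independent over K', η_1,…,η_{2d−2} are algebraically independent over K'(b), and Φ_1,…,Φ_{2d−2} are the polar forms defined by G(Z̃_0, Z̃_1+η_1Z̃_0,…,Z̃_{2d−2}+η_{2d−2}Z̃_0, Z̃_{2d−1},…,Z̃_q, Y) = Σ_{s=1}^{2d} Z̃_0^{2d−s}Φ_s(Z̃_1,…,Z̃_q,Y). Let F*_η ⊂ {Z̃_0 = 0} ≅ P^{r−1} be defined by Φ_1 = … = Φ_{2d−2} = 0, set φ_s = Φ_s(1, z̃_2,…,z̃_q, y_{q+1},…,y_r), let K_2 = K'(b,η), and assume the ideal (φ_1,…,φ_{2d−2}) of K_2[z̃_2,…,z̃_q,y_{q+1},…,y_r]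 is prime. Then the fraction field of K_2[z̃,y]/(φ_1,…,φ_{2d−2}) admits a K_2-algebra embedding into a rational function field K_2(t_1,…,t_N) for some N; that is, F*_η is unirational over the field K'(b,η) = K(l(L_0), η, θ(B)). -/

import Mathlib

set_option synthInstance.maxHeartbeats 1000000
set_option maxHeartbeats 1000000

universe u

/-- The conclusion of the Morin–Predonzan theorem in Ciliberto's version, for a base
field `K`, a multidegree `dv : Fin m → ℕ`, and candidate constants `c` and `q`:
for every `r ≥ c` (with `q < r`), whenever `G 1, …, G m` are homogeneous forms of degrees
`dv 1, …, dv m` in the variables `Z_0, …, Z_q, Y_{q+1}, …, Y_r`, each of whose monomials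
involves at least one `Y`-variable (a variable of index `> q`), whose coefficients (in
an extension field `K1` of `K` generated by them) are all together algebraically
independent over `K`, and such that the ideal generated by the dehomogenizations
`g j = G j (1, z, y)` is prime, the fraction field of `K1[z,y]/(g_1, …, g_m)` admits a
`K1`-algebra embedding into a rational function field over `K1`. -/
def MPCProperty (K : Type u) [Field K] (m : ℕ) (dv : Fin m → ℕ) (c q : ℕ) : Prop :=
  ∀ r : ℕ, c ≤ r → q < r →
    ∀ (K1 : Type u) [Field K1] [Algebra K K1]
      (G : Fin m → MvPolynomial (Fin (r + 1)) K1),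
      (∀ j, (G j).IsHomogeneous (dv j)) →
      (∀ j, ∀ μ ∈ (G j).support, ∃ i : Fin (r + 1), q < (i : ℕ) ∧ μ i ≠ 0) →
      AlgebraicIndependent K (fun p : (Σ j : Fin m, {μ : Fin (r + 1) →₀ ℕ //
          (∑ i, μ i) = dv j ∧ ∃ i : Fin (r + 1), q < (i : ℕ) ∧ μ i ≠ 0}) =>
        (G p.1).coeff p.2.1) →
      IntermediateField.adjoin K (⋃ j, Set.range (G j).coeff) = ⊤ →
      (Ideal.span (Set.range fun j => MvPolynomial.aeval
          (fun i : Fin (r + 1) =>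
            Fin.cases (motive := fun _ => MvPolynomial (Fin r) K1) 1
              (fun i' => MvPolynomial.X i') i) (G j))).IsPrime →
      ∃ (N : ℕ) (ψ : FractionRing ((MvPolynomial (Fin r) K1) ⧸
          (Ideal.span (Set.range fun j => MvPolynomial.aeval
            (fun i : Fin (r + 1) =>
              Fin.cases (motive := fun _ => MvPolynomial (Fin r) K1) 1
                (fun i' => MvPolynomial.X i') i) (G j)))) →ₐ[K1]
            FractionRing (MvPolynomial (Fin N) K1)),
        Function.Injective ψ

open MvPolynomial in
theorem aux_decomp {k L ι σ : Type*} [Field k] [Field L] [Algebra k L] (e : Module.Basis ι k L)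
    (p : MvPolynomial σ L) : ∃ f : ι →₀ MvPolynomial σ k,
      p = f.sum fun i a => C (e i) * map (algebraMap k L) a := by
  induction p using MvPolynomial.induction_on' with
  | monomial m a =>
    refine ⟨(e.repr a).mapRange (monomial m) (by simp), ?_⟩
    rw [Finsupp.sum_mapRange_index (by simp)]
    conv_lhs => rw [← e.linearCombination_repr a, Finsupp.linearCombination_apply]
    simp only [Finsupp.sum, map_sum, map_monomial, C_mul_monomial, Algebra.smul_def]
    exact Finset.sum_congr rfl fun i _ => by rw [mul_comm]
  | add p q hp hq =>
    obtain ⟨f, rfl⟩ := hp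
    obtain ⟨g, rfl⟩ := hq
    refine ⟨f + g, ?_⟩
    classical
    rw [Finsupp.sum_add_index'] <;> simp [mul_add]

open MvPolynomial in
theorem aux_linInd {k L ι σ : Type*} [Field k] [Field L] [Algebra k L] (e : Module.Basis ι k L)
    (f : ι →₀ MvPolynomial σ k)
    (h : (f.sum fun i a => C (e i) * map (algebraMap k L) a) = 0) : f = 0 := by
  ext i m
  have h2 := congrArg (coeff m) h
  simp only [Finsupp.sum, coeff_sum, coeff_C_mul, coeff_map, coeff_zero] at h2
  have := (linearIndependent_iff'.1 e.linearIndependent) f.support (fun i => coeff m (f i))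
    (by rw [← h2]; simp [Algebra.smul_def, mul_comm])
  by_cases hi : i ∈ f.support
  · simpa using this i hi
  · simp [Finsupp.notMem_support_iff.1 hi]

open MvPolynomial in
theorem aux_linInd' {k L ι σ E1 E2 : Type*} [Field k] [Field L] [Algebra k L]
    [Field E1] [Field E2] [Algebra (MvPolynomial σ k) E1] [Algebra (MvPolynomial σ L) E2]
    [IsFractionRing (MvPolynomial σ k) E1] [IsFractionRing (MvPolynomial σ L) E2]
    (e : Module.Basis ι k L) (θ : E1 →+* E2)
    (hθ : ∀ a, θ (algebraMap (MvPolynomial σ k) _ a) =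
      algebraMap (MvPolynomial σ L) _ (map (algebraMap k L) a))
    (f : ι →₀ E1)
    (h : (f.sum fun i a => algebraMap (MvPolynomial σ L) E2 (C (e i)) * θ a) = 0) : f = 0 := by
  let _ : Algebra E1 E2 := θ.toAlgebra
  let _ : Algebra (MvPolynomial σ k) E2 :=
    ((algebraMap (MvPolynomial σ L) E2).comp (map (algebraMap k L))).toAlgebra
  have : IsScalarTower (MvPolynomial σ k) E1 E2 :=
    IsScalarTower.of_algebraMap_eq fun x => (hθ x).symm
  have h1 : LinearIndependent (MvPolynomial σ k)
      (fun i => algebraMap (MvPolynomial σ L) E2 (C (e i))) := by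
    rw [linearIndependent_iff]
    intro l hl
    apply aux_linInd e
    apply IsFractionRing.injective (MvPolynomial σ L) E2
    rw [map_zero, ← hl, Finsupp.linearCombination_apply]
    simp only [Finsupp.sum, map_sum, Algebra.smul_def, map_mul]
    refine Finset.sum_congr rfl fun i _ => mul_comm _ _
  rw [LinearIndependent.iff_fractionRing (R := MvPolynomial σ k) (K := E1),
    linearIndependent_iff] at h1
  apply h1
  rw [← h, Finsupp.linearCombination_apply]
  refine Finset.sum_congr rfl fun i _ => ?_
  exact (Algebra.smul_def _ _).trans (mul_comm _ _)

open MvPolynomial in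
theorem aux_comap {k L σ : Type*} [Field k] [Field L] [Algebra k L]
    (J1 : Ideal (MvPolynomial σ k)) (f : MvPolynomial σ k)
    (hf : map (algebraMap k L) f ∈ J1.map (map (algebraMap k L))) : f ∈ J1 := by
  classical
  obtain ⟨ρ, hρ⟩ := (Algebra.linearMap k L).exists_leftInverse_of_injective
    (LinearMap.ker_eq_bot.2 (algebraMap k L).injective)
  have hρ' : ∀ a, ρ (algebraMap k L a) = a := fun a => by
    simpa using LinearMap.congr_fun hρ a
  have ex : ∀ x : MvPolynomial σ L, ∃ g : MvPolynomial σ k, ∀ m, coeff m g = ρ (coeff m x) := by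
    intro x
    refine ⟨∑ m ∈ x.support, monomial m (ρ (coeff m x)), fun m => ?_⟩
    simp only [coeff_sum, coeff_monomial, Finset.sum_ite_eq', mem_support_iff]
    split_ifs with h
    · rfl
    · rw [not_not] at h
      simp [h]
  have key : ∀ p ∈ J1.map (map (algebraMap k L)), ∀ g : MvPolynomial σ k,
      (∀ m, coeff m g = ρ (coeff m p)) → g ∈ J1 := by
    intro p hp
    refine Submodule.closure_induction ?_ ?_ ?_ hp
    · intro g hg
      have : g = 0 := by ext m; simp [hg]
      exact this ▸ J1.zero_mem
    · intro x y _ _ hx hy g hg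
      obtain ⟨gx, hgx⟩ := ex x
      obtain ⟨gy, hgy⟩ := ex y
      have : g = gx + gy := by ext m; simp [hg, hgx, hgy]
      exact this ▸ J1.add_mem (hx gx hgx) (hy gy hgy)
    · rintro a _ ⟨b, hb, rfl⟩ g hg
      obtain ⟨ga, hga⟩ := ex a
      have : g = ga * b := by
        ext m
        rw [hg, smul_eq_mul, coeff_mul, coeff_mul, map_sum]
        refine Finset.sum_congr rfl fun i _ => ?_
        rw [coeff_map, hga, mul_comm, ← Algebra.smul_def, map_smul, smul_eq_mul, mul_comm]
      exact this ▸ J1.mul_mem_left _ hb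
  exact key _ hf f (fun m => by rw [coeff_map, hρ'])

open MvPolynomial in
theorem aux_base_change {k L : Type*} [Field k] [Field L] [Algebra k L] {n : ℕ}
    (J1 : Ideal (MvPolynomial (Fin n) k)) (J : Ideal (MvPolynomial (Fin n) L))
    (hJ : J = J1.map (map (algebraMap k L))) (hp : J.IsPrime)
    (H : J1.IsPrime → ∃ (N : ℕ) (ψ : FractionRing (MvPolynomial (Fin n) k ⧸ J1) →ₐ[k]
      FractionRing (MvPolynomial (Fin N) k)), Function.Injective ψ) :
    ∃ (N : ℕ) (ψ : FractionRing (MvPolynomial (Fin n) L ⧸ J) →ₐ[L]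
      FractionRing (MvPolynomial (Fin N) L)), Function.Injective ψ := by
  have hc : J1 = J.comap (map (algebraMap k L)) := by
    rw [hJ]
    exact le_antisymm Ideal.le_comap_map fun f hf => aux_comap J1 f hf
  have hp1 : J1.IsPrime := hc ▸ Ideal.IsPrime.comap _
  obtain ⟨N, ψ, hψ⟩ := H hp1
  refine ⟨N, ?_⟩
  have hinj : Function.Injective ((algebraMap (MvPolynomial (Fin N) L)
      (FractionRing (MvPolynomial (Fin N) L))).comp (map (algebraMap k L))) :=
    (IsFractionRing.injective _ _).comp (map_injective _ (algebraMap k L).injective)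
  let θ : FractionRing (MvPolynomial (Fin N) k) →+* FractionRing (MvPolynomial (Fin N) L) :=
    IsFractionRing.lift hinj
  have hθ : ∀ a, θ (algebraMap (MvPolynomial (Fin N) k) _ a) =
      algebraMap (MvPolynomial (Fin N) L) _ (map (algebraMap k L) a) := fun a =>
    IsFractionRing.lift_algebraMap hinj a
  -- the map from `k[x]`
  let π : MvPolynomial (Fin n) k →ₐ[k] FractionRing (MvPolynomial (Fin N) k) :=
    ψ.comp ((Algebra.ofId (MvPolynomial (Fin n) k ⧸ J1)
      (FractionRing (MvPolynomial (Fin n) k ⧸ J1))).restrictScalars k |>.comp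
        (Ideal.Quotient.mkₐ k J1))
  have hπ : ∀ f, π f = 0 ↔ f ∈ J1 := by
    intro f
    have : π f = ψ (algebraMap (MvPolynomial (Fin n) k ⧸ J1) _ (Ideal.Quotient.mk J1 f)) := rfl
    rw [this, map_eq_zero_iff _ hψ,
      map_eq_zero_iff _ (IsFractionRing.injective _ _), Ideal.Quotient.eq_zero_iff_mem]
  let Ψ : MvPolynomial (Fin n) L →ₐ[L] FractionRing (MvPolynomial (Fin N) L) :=
    aeval fun i => θ (π (X i))
  have hΨC : ∀ a : L, Ψ (C a) = algebraMap (MvPolynomial (Fin N) L) _ (C a) := by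
    intro a
    rw [← algebraMap_eq, AlgHom.commutes, ← algebraMap_eq, ← IsScalarTower.algebraMap_apply]
  have hΨ : ∀ f, Ψ (map (algebraMap k L) f) = θ (π f) := by
    intro f
    have h1 : (Ψ.toRingHom.comp (map (algebraMap k L))) = θ.comp π.toRingHom := by
      apply MvPolynomial.ringHom_ext
      · intro a
        simp only [RingHom.comp_apply, map_C]
        have e1 : π.toRingHom (C a) = algebraMap (MvPolynomial (Fin N) k) _ (C a) := by
          change π (C a) = _
          rw [← algebraMap_eq, AlgHom.commutes, ← algebraMap_eq,
            ← IsScalarTower.algebraMap_apply]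
        rw [e1, hθ, map_C]
        exact hΨC _
      · intro i
        simp [Ψ]
    exact RingHom.congr_fun h1 f
  have hker : ∀ p, Ψ p = 0 ↔ p ∈ J := by
    intro p
    constructor
    · intro h
      let e := Module.Basis.ofVectorSpace k L
      obtain ⟨f, rfl⟩ := aux_decomp e p
      have := aux_linInd' (σ := Fin N) e θ hθ (f.mapRange π (map_zero _)) (by
        rw [Finsupp.sum_mapRange_index (by simp), ← h]
        simp only [Finsupp.sum, map_sum, map_mul, hΨ]
        refine Finset.sum_congr rfl fun i _ => ?_
        congr 1
        exact (hΨC _).symm)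
      refine Ideal.sum_mem _ fun i _ => Ideal.mul_mem_left _ _ ?_
      have hi : π (f i) = 0 := by simpa using DFunLike.congr_fun this i
      rw [hJ]
      exact Ideal.mem_map_of_mem _ ((hπ _).1 hi)
    · intro h
      have hle : J ≤ RingHom.ker Ψ := by
        rw [hJ, Ideal.map_le_iff_le_comap]
        intro f hf
        rw [Ideal.mem_comap, RingHom.mem_ker, hΨ, (hπ f).2 hf, map_zero]
      exact hle h
  let Ψ' : MvPolynomial (Fin n) L ⧸ J →ₐ[L] FractionRing (MvPolynomial (Fin N) L) :=
    Ideal.Quotient.liftₐ J Ψ fun a ha => (hker a).2 ha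
  have hΨ' : Function.Injective Ψ' := by
    rw [injective_iff_map_eq_zero]
    intro a ha
    obtain ⟨a, rfl⟩ := Ideal.Quotient.mk_surjective a
    rw [Ideal.Quotient.eq_zero_iff_mem]
    exact (hker a).1 ha
  exact ⟨IsFractionRing.liftAlgHom hΨ', RingHom.injective _⟩

open MvPolynomial in
theorem aux_lift {k K ρ : Type*} [Field k] [Field K] [Algebra k K]
    (L : IntermediateField k K) (x : MvPolynomial ρ K) (hx : ∀ m, coeff m x ∈ L) :
    x ∈ Set.range (map (σ := ρ) (algebraMap L K)) := by
  rw [mem_range_map_iff_coeffs_subset]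
  intro a ha
  obtain ⟨n, _, rfl⟩ := mem_coeffs_iff.1 ha
  exact ⟨⟨_, hx n⟩, rfl⟩

open MvPolynomial in
theorem aux_coeff_mem {k K σ τ : Type*} [Field k] [Field K] [Algebra k K]
    (L : IntermediateField k K) (p : MvPolynomial σ K) (g : σ → MvPolynomial τ K)
    (hp : ∀ m, coeff m p ∈ L) (hg : ∀ i m, coeff m (g i) ∈ L) (m : τ →₀ ℕ) :
    coeff m (aeval g p) ∈ L := by
  obtain ⟨p0, rfl⟩ := aux_lift L p hp
  choose g0 hg0 using fun i => aux_lift L (g i) (hg i)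
  have : aeval g (map (algebraMap L K) p0) = map (algebraMap L K) (aeval g0 p0) := by
    rw [aeval_map_algebraMap]
    have h2 : (aeval g : MvPolynomial σ L →ₐ[L] MvPolynomial τ K) =
        (mapAlgHom (Algebra.ofId L K)).comp (aeval g0) := by
      ext1 i
      simp only [aeval_X, AlgHom.comp_apply, ← hg0]
      rfl
    rw [h2]; rfl
  rw [this, coeff_map]
  exact (coeff m (aeval g0 p0)).2

open MvPolynomial in
theorem aux_algInd (K' : Type u) [Field K'] (d q r : ℕ)
    (hdq : 2 * d - 2 ≤ q) (hqr : q < r)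
    (K2 : Type u) [Field K2] [Algebra K' K2]
    (G : MvPolynomial (Fin (r + 1)) K2) (hG : G.IsHomogeneous (2 * d))
    (hY : ∀ μ ∈ G.support, ∃ i : Fin (r + 1), q < (i : ℕ) ∧ μ i ≠ 0)
    (hb : AlgebraicIndependent K'
      (fun μ : {μ : Fin (r + 1) →₀ ℕ //
        (∑ i, μ i) = 2 * d ∧ ∃ i : Fin (r + 1), q < (i : ℕ) ∧ μ i ≠ 0} => G.coeff μ.1))
    (η : Fin (r + 1) → K2) (hη0 : η 0 = 1)
    (hηz : ∀ i : Fin (r + 1), 2 * d - 2 < (i : ℕ) → η i = 0)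
    (hηind : AlgebraicIndependent
      (↥(IntermediateField.adjoin K' (Set.range G.coeff)))
      (fun j : Fin (2 * d - 2) => η ⟨(j : ℕ) + 1, by have := j.isLt; omega⟩))
    (hgen : IntermediateField.adjoin K' (Set.range G.coeff ∪ Set.range η) = ⊤)
    (P : MvPolynomial (Fin (r + 1)) K2)
    (hP : P = MvPolynomial.aeval (fun i : Fin (r + 1) =>
        if i = 0 then MvPolynomial.X 0
        else MvPolynomial.X i + MvPolynomial.C (η i) * MvPolynomial.X 0) G) :
    P.IsHomogeneous (2 * d) ∧
    (∀ μ ∈ P.support, ∃ i : Fin (r + 1), q < (i : ℕ) ∧ μ i ≠ 0) ∧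
    AlgebraicIndependent K'
      (fun μ : {μ : Fin (r + 1) →₀ ℕ //
        (∑ i, μ i) = 2 * d ∧ ∃ i : Fin (r + 1), q < (i : ℕ) ∧ μ i ≠ 0} => P.coeff μ.1) := by
  classical
  have hPh : P.IsHomogeneous (2 * d) := by
    rw [hP]
    have := hG.aeval (S := K2) (n := 1) (fun i : Fin (r + 1) =>
        if i = 0 then (X 0 : MvPolynomial (Fin (r + 1)) K2)
        else X i + C (η i) * X 0) (by
      intro i
      split_ifs
      · exact isHomogeneous_X _ _
      · exact (isHomogeneous_X _ _).add (by
          simpa using (isHomogeneous_C (Fin (r+1)) (η i)).mul (isHomogeneous_X K2 (0 : Fin (r + 1)))))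
    rwa [one_mul] at this
  have hPY : ∀ μ ∈ P.support, ∃ i : Fin (r + 1), q < (i : ℕ) ∧ μ i ≠ 0 := by
    have h1 : G ∈ Ideal.span (X '' {i : Fin (r + 1) | q < (i : ℕ)}) :=
      mem_ideal_span_X_image.2 hY
    refine mem_ideal_span_X_image (s := {i : Fin (r + 1) | q < (i : ℕ)}).1 ?_
    have h2 := Ideal.mem_map_of_mem (aeval (fun i : Fin (r + 1) =>
        if i = 0 then (X 0 : MvPolynomial (Fin (r + 1)) K2)
        else X i + C (η i) * X 0)) h1
    rw [← hP] at h2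
    refine (?_ : Ideal.map _ _ ≤ _) h2
    rw [Ideal.map_span, Ideal.span_le]
    rintro _ ⟨_, ⟨i, hi, rfl⟩, rfl⟩
    have hi' : q < (i : ℕ) := hi
    have hi0 : i ≠ 0 := by rintro rfl; simp at hi'
    apply Ideal.subset_span
    refine ⟨i, hi, ?_⟩
    simp [hi0, hηz i (by omega)]
  refine ⟨hPh, hPY, ?_⟩
  set T := {μ : Fin (r + 1) →₀ ℕ //
        (∑ i, μ i) = 2 * d ∧ ∃ i : Fin (r + 1), q < (i : ℕ) ∧ μ i ≠ 0} with hT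
  have hTfin : Finite T := by
    refine Finite.of_injective (β := Fin (r + 1) → Fin (2 * d + 1))
      (fun μ i => ⟨μ.1 i, Nat.lt_succ_of_le ((Finset.single_le_sum (f := fun i => μ.1 i)
        (fun _ _ => Nat.zero_le _) (Finset.mem_univ i)).trans_eq μ.2.1)⟩) ?_
    intro a b hab
    apply Subtype.ext
    ext i
    exact congrArg Fin.val (congrFun hab i)
  have hx := hb.sumElim_of_tower (S := IntermediateField.adjoin K' (Set.range G.coeff)) (by
    rintro _ ⟨μ, rfl⟩
    exact ⟨⟨_, IntermediateField.subset_adjoin _ _ ⟨μ.1, rfl⟩⟩, rfl⟩) hηind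
  set ηf := (fun j : Fin (2 * d - 2) => η ⟨(j : ℕ) + 1, by have := j.isLt; omega⟩) with hηf
  let y : Fin (2 * d - 2) ⊕ T → K2 := Sum.elim ηf (fun μ => P.coeff μ.1)
  have htop : IntermediateField.adjoin K' (Set.range y) = ⊤ := by
    set L := IntermediateField.adjoin K' (Set.range y) with hL
    have hyL : ∀ i, y i ∈ L := fun i => IntermediateField.subset_adjoin _ _ ⟨i, rfl⟩
    have hηL : ∀ i, η i ∈ L := by
      intro i
      by_cases h0 : i = 0
      · rw [h0, hη0]; exact L.one_mem
      by_cases hi : 2 * d - 2 < (i : ℕ)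
      · rw [hηz i hi]; exact L.zero_mem
      have hi1 : (i : ℕ) ≠ 0 := fun h => h0 (Fin.ext h)
      convert hyL (Sum.inl ⟨(i : ℕ) - 1, by omega⟩)
      simp only [y, hηf, Sum.elim_inl]
      congr 1
      ext
      simp; omega
    have hPL : ∀ m, coeff m P ∈ L := by
      intro m
      by_cases hm : m ∈ P.support
      · refine hyL (Sum.inr ⟨m, ?_, hPY m hm⟩)
        have := hPh (mem_support_iff.1 hm)
        rw [← this, Finsupp.weight_apply, Finsupp.sum_fintype _ _ (by simp)]
        simp
      · rw [notMem_support_iff.1 hm]; exact L.zero_mem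
    have hGP : G = aeval (fun i : Fin (r + 1) =>
        if i = 0 then (X 0 : MvPolynomial (Fin (r + 1)) K2)
        else X i + C (-η i) * X 0) P := by
      rw [hP]
      conv_lhs => rw [← AlgHom.id_apply (R := K2) G]
      rw [← AlgHom.comp_apply]
      congr 1
      ext1 i
      by_cases h0 : i = 0
      · simp [h0]
      · simp only [AlgHom.comp_apply, aeval_X, if_neg h0, map_add, map_mul, AlgHom.id_apply,
          ← algebraMap_eq, AlgHom.commutes]
        simp
    rw [eq_top_iff, ← hgen, IntermediateField.adjoin_le_iff]
    rintro _ (⟨m, rfl⟩ | ⟨i, rfl⟩)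
    · change coeff m G ∈ L
      rw [hGP]
      refine aux_coeff_mem L _ _ hPL ?_ m
      intro i m
      split_ifs
      · rw [coeff_X]; split_ifs
        · exact L.one_mem
        · exact L.zero_mem
      · rw [coeff_add, coeff_C_mul, coeff_X, coeff_X]
        refine L.add_mem ?_ (L.mul_mem (L.neg_mem (hηL i)) ?_) <;> split_ifs
        · exact L.one_mem
        · exact L.zero_mem
        · exact L.one_mem
        · exact L.zero_mem
    · exact hηL i
  have halg : Algebra.IsAlgebraic (Algebra.adjoin K' (Set.range y)) K2 := by
    constructor
    intro z
    have hz : z ∈ IntermediateField.adjoin K' (Set.range y) := htop ▸ IntermediateField.mem_top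
    rw [IntermediateField.mem_adjoin_iff_div] at hz
    obtain ⟨a, ha, b, hb, rfl⟩ := hz
    rw [div_eq_mul_inv]
    exact (isAlgebraic_algebraMap (⟨a, ha⟩ : Algebra.adjoin K' (Set.range y))).mul
      (isAlgebraic_algebraMap (⟨b, hb⟩ : Algebra.adjoin K' (Set.range y))).inv
  have hy := Algebra.IsAlgebraic.isTranscendenceBasis_of_lift_le_trdeg_of_finite K' y
    hx.lift_cardinalMk_le_trdeg
  exact hy.1.comp Sum.inr Sum.inr_injective

/-- **Unirationality of `F*_η` (Corollary to the polar-genericity lemma).** In the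
situation of the polar-genericity lemma — `K'` of characteristic zero, `d ≥ 3`,
`2d - 2 ≤ q < r`, `G = Σ_{|I|<2d} b_{I,J} Z^I Y^J` homogeneous of degree `2d` in
`Z_0, …, Z_q, Y_{q+1}, …, Y_r` with every monomial involving a `Y`-variable and all
coefficients algebraically independent over `K'`, `η_1, …, η_{2d-2}` algebraically
independent over `K'(b)`, and `Φ_1, …, Φ_{2d}` the polar forms defined by
`G(Z̃_0, Z̃_1 + η_1 Z̃_0, …, Z̃_{2d-2} + η_{2d-2} Z̃_0, Z̃_{2d-1}, …, Z̃_q, Y)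
  = Σ_{s=1}^{2d} Z̃_0^{2d-s} Φ_s(Z̃_1, …, Z̃_q, Y)` —
assume moreover that `r - 1 ≥ c(d̲)` and `q - 1 = q(d̲)` where `c(d̲)`, `q(d̲)` are
constants for which the Morin–Predonzan–Ciliberto theorem holds (`MPCProperty`) for the
multidegree `d̲ = (1, 2, …, 2d-2)`. Let `F*_η ⊂ {Z̃_0 = 0} ≅ ℙ^{r-1}` be defined by
`Φ_1 = … = Φ_{2d-2} = 0`, let `φ_s = Φ_s(1, z̃_2, …, z̃_q, y_{q+1}, …, y_r)`, let
`K_2 = K'(b, η)` (realized as the field generated over `K'` by the coefficients of `G`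
together with the `η`'s), and assume the ideal `J = (φ_1, …, φ_{2d-2})` of `K_2[z̃, y]`
is prime. Then the fraction field of `K_2[z̃, y]/J` admits a `K_2`-algebra embedding
into a rational function field `K_2(t_1, …, t_N)`; that is, `F*_η` is unirational over
`K_2 = K(l(L₀), η, θ(B))`. -/
theorem stmt_7 (K' : Type u) [Field K'] [CharZero K'] (d q r c q0 : ℕ)
    (hd : 3 ≤ d) (hdq : 2 * d - 2 ≤ q) (hqr : q < r)
    (hMPC : MPCProperty K' (2 * d - 2) (fun j => (j : ℕ) + 1) c q0)
    (hq0 : q0 + 1 = q) (hrc : c ≤ r - 1)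
    (K2 : Type u) [Field K2] [Algebra K' K2]
    (G : MvPolynomial (Fin (r + 1)) K2) (hG : G.IsHomogeneous (2 * d))
    (hY : ∀ μ ∈ G.support, ∃ i : Fin (r + 1), q < (i : ℕ) ∧ μ i ≠ 0)
    (hb : AlgebraicIndependent K'
      (fun μ : {μ : Fin (r + 1) →₀ ℕ //
        (∑ i, μ i) = 2 * d ∧ ∃ i : Fin (r + 1), q < (i : ℕ) ∧ μ i ≠ 0} => G.coeff μ.1))
    (η : Fin (r + 1) → K2) (hη0 : η 0 = 1)
    (hηz : ∀ i : Fin (r + 1), 2 * d - 2 < (i : ℕ) → η i = 0)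
    (hηind : AlgebraicIndependent
      (↥(IntermediateField.adjoin K' (Set.range G.coeff)))
      (fun j : Fin (2 * d - 2) => η ⟨(j : ℕ) + 1, by have := j.isLt; omega⟩))
    (hgen : IntermediateField.adjoin K' (Set.range G.coeff ∪ Set.range η) = ⊤)
    (Φ : ℕ → MvPolynomial (Fin (r + 1)) K2)
    (hΦdec : MvPolynomial.aeval (fun i : Fin (r + 1) =>
        if i = 0 then MvPolynomial.X 0
        else MvPolynomial.X i + MvPolynomial.C (η i) * MvPolynomial.X 0) G
      = ∑ s ∈ Finset.Icc 1 (2 * d), MvPolynomial.X 0 ^ (2 * d - s) * Φ s)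
    (hΦhom : ∀ s ∈ Finset.Icc 1 (2 * d), (Φ s).IsHomogeneous s)
    (hΦ0 : ∀ s ∈ Finset.Icc 1 (2 * d), ∀ μ ∈ (Φ s).support, μ 0 = 0)
    (φ : ℕ → MvPolynomial (Fin (r - 1)) K2)
    (hφ : ∀ s, φ s = MvPolynomial.aeval (fun i : Fin (r + 1) =>
      if _h1 : (i : ℕ) = 0 then 0
      else if _h2 : (i : ℕ) = 1 then 1
      else MvPolynomial.X (⟨(i : ℕ) - 2, by have := i.isLt; omega⟩ : Fin (r - 1)))
      (Φ s))
    (J : Ideal (MvPolynomial (Fin (r - 1)) K2))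
    (hJ : J = Ideal.span {p | ∃ s : ℕ, 1 ≤ s ∧ s ≤ 2 * d - 2 ∧ p = φ s})
    (hJprime : J.IsPrime) :
    ∃ (N : ℕ) (ψ : FractionRing ((MvPolynomial (Fin (r - 1)) K2) ⧸ J) →ₐ[K2]
        FractionRing (MvPolynomial (Fin N) K2)),
      Function.Injective ψ := by
  classical
  obtain ⟨hPh, hPY, hPind⟩ := aux_algInd K' d q r hdq hqr K2 G hG hY hb η hη0 hηz hηind hgen _ rfl
  rw [hΦdec] at hPh hPY hPind
  obtain ⟨r, rfl⟩ : ∃ r', r = r' + 1 := ⟨r - 1, by omega⟩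
  -- coefficients of the polar forms are coefficients of the transformed form
  have hcoef : ∀ s ∈ Finset.Icc 1 (2 * d), ∀ μ : Fin (r + 1 + 1) →₀ ℕ, μ 0 = 0 →
      MvPolynomial.coeff (Finsupp.single 0 (2 * d - s) + μ)
        (∑ s ∈ Finset.Icc 1 (2 * d), MvPolynomial.X 0 ^ (2 * d - s) * Φ s) =
      MvPolynomial.coeff μ (Φ s) := by
    intro s hs μ hμ
    rw [MvPolynomial.coeff_sum, Finset.sum_eq_single_of_mem s hs]
    · rw [MvPolynomial.X_pow_eq_monomial, MvPolynomial.coeff_monomial_mul, one_mul]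
    · intro t ht hts
      rw [MvPolynomial.X_pow_eq_monomial, MvPolynomial.coeff_monomial_mul']
      split_ifs with hle
      · rw [one_mul]
        by_contra hne
        have h0 := hΦ0 t ht _ (MvPolynomial.mem_support_iff.2 hne)
        have h1 := hle 0
        simp [hμ] at h0 h1
        simp only [Finset.mem_Icc] at ht hs
        omega
      · rfl
  have hmem : ∀ j : Fin (2 * d - 2), (j : ℕ) + 1 ∈ Finset.Icc 1 (2 * d) := fun j => by
    have := j.isLt
    simp only [Finset.mem_Icc]
    omega
  -- remove the variable `Z̃_0`
  have hren : ∀ j : Fin (2 * d - 2), ∃ g : MvPolynomial (Fin (r + 1)) K2,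
      MvPolynomial.rename Fin.succ g = Φ ((j : ℕ) + 1) := by
    intro j
    refine MvPolynomial.exists_rename_eq_of_vars_subset_range _ Fin.succ
      (Fin.succ_injective _) ?_
    intro i hi
    obtain ⟨μ, hμ, hiμ⟩ := (MvPolynomial.mem_vars_iff_mem_support i).1 hi
    have h0 := hΦ0 _ (hmem j) μ hμ
    have : i ≠ 0 := by
      rintro rfl
      exact (Finsupp.mem_support_iff.1 hiμ) h0
    exact ⟨i.pred this, Fin.succ_pred i this⟩
  choose g hg using hren
  let K1 : IntermediateField K' K2 :=
    IntermediateField.adjoin K' (⋃ j, Set.range (g j).coeff)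
  choose G1 hG1 using fun j => aux_lift K1 (g j) (fun m =>
    IntermediateField.subset_adjoin _ _ (Set.mem_iUnion.2 ⟨j, m, rfl⟩))
  have hG1c : ∀ j m, algebraMap K1 K2 ((G1 j).coeff m) =
      (Φ ((j : ℕ) + 1)).coeff (m.mapDomain Fin.succ) := by
    intro j m
    rw [← hg j, MvPolynomial.coeff_rename_mapDomain _ (Fin.succ_injective _), ← hG1 j,
      MvPolynomial.coeff_map]
  have hmd0 : ∀ m : Fin (r + 1) →₀ ℕ, m.mapDomain Fin.succ 0 = 0 := fun m =>
    Finsupp.mapDomain_of_notMem_range _ _ (by rintro ⟨x, hx⟩; exact Fin.succ_ne_zero x hx)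
  have hmds : ∀ (m : Fin (r + 1) →₀ ℕ) (i : Fin (r + 1)), m.mapDomain Fin.succ i.succ = m i :=
    fun m i => Finsupp.mapDomain_apply (Fin.succ_injective _) _ _
  let dh : MvPolynomial (Fin (r + 1)) K1 →ₐ[K1] MvPolynomial (Fin r) K1 :=
    MvPolynomial.aeval (fun i : Fin (r + 1) =>
            Fin.cases (motive := fun _ => MvPolynomial (Fin r) K1) 1
              (fun i' => MvPolynomial.X i') i)
  have hφ1 : ∀ j : Fin (2 * d - 2), φ ((j : ℕ) + 1) =
      MvPolynomial.map (algebraMap K1 K2) (dh (G1 j)) := by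
    intro j
    rw [hφ, ← hg, ← hG1, MvPolynomial.aeval_rename, MvPolynomial.aeval_map_algebraMap]
    have h2 : (MvPolynomial.aeval ((fun i : Fin (r + 1 + 1) =>
      if _h1 : (i : ℕ) = 0 then (0 : MvPolynomial (Fin (r + 1 - 1)) K2)
      else if _h2 : (i : ℕ) = 1 then 1
      else MvPolynomial.X (⟨(i : ℕ) - 2, by have := i.isLt; omega⟩ : Fin (r + 1 - 1))) ∘ Fin.succ) :
        MvPolynomial (Fin (r + 1)) K1 →ₐ[K1] MvPolynomial (Fin r) K2) =
        (MvPolynomial.mapAlgHom (Algebra.ofId K1 K2)).comp dh := by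
      ext1 i
      rw [AlgHom.comp_apply]
      refine (MvPolynomial.aeval_X _ _).trans ?_
      refine Eq.trans ?_ (congrArg _ (MvPolynomial.aeval_X _ _).symm)
      refine Fin.cases ?_ (fun i => ?_) i
      · simp
      · simp
    rw [h2]; rfl
  refine aux_base_change (k := K1) (L := K2) (n := r) (Ideal.span (Set.range fun j => dh (G1 j)))
    J ?_ hJprime ?_
  · rw [hJ, Ideal.map_span]
    congr 1
    ext p
    constructor
    · rintro ⟨s, h1, h2, rfl⟩
      refine ⟨_, ⟨⟨s - 1, by omega⟩, rfl⟩, ?_⟩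
      rw [← hφ1]
      congr 1
      exact Nat.sub_add_cancel h1
    · rintro ⟨_, ⟨j, rfl⟩, rfl⟩
      refine ⟨(j : ℕ) + 1, by omega, by omega, ?_⟩
      rw [hφ1]
  · intro hp1
    refine hMPC r hrc (by omega) K1 G1 ?_ ?_ ?_ ?_ hp1
    · intro j
      have h1 : (Φ ((j : ℕ) + 1)).IsHomogeneous ((j : ℕ) + 1) := hΦhom _ (hmem j)
      rw [← hg, MvPolynomial.IsHomogeneous.rename_isHomogeneous_iff (Fin.succ_injective _),
        ← hG1] at h1
      exact MvPolynomial.IsHomogeneous.of_map (algebraMap K1 K2).injective h1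
    · intro j μ hμ
      have h1 : (Φ ((j : ℕ) + 1)).coeff (μ.mapDomain Fin.succ) ≠ 0 := by
        rw [← hG1c]
        exact (map_ne_zero _).2 (MvPolynomial.mem_support_iff.1 hμ)
      rw [← hcoef _ (hmem j) _ (hmd0 μ)] at h1
      obtain ⟨i, hqi, hi⟩ := hPY _ (MvPolynomial.mem_support_iff.2 h1)
      have hi0 : i ≠ 0 := by rintro rfl; simp at hqi
      obtain ⟨i, rfl⟩ := Fin.exists_succ_eq.2 hi0
      refine ⟨i, ?_, ?_⟩
      · simp at hqi; omega
      · rw [Finsupp.add_apply, hmds] at hi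
        simpa using hi
    · rw [← AlgHom.algebraicIndependent_iff (Algebra.ofId K1 K2 |>.restrictScalars K')
        (algebraMap K1 K2).injective]
      have hE := hPind.comp (ι' := (Σ j : Fin (2 * d - 2), {μ : Fin (r + 1) →₀ ℕ //
          (∑ i, μ i) = (j : ℕ) + 1 ∧ ∃ i : Fin (r + 1), q0 < (i : ℕ) ∧ μ i ≠ 0}))
        (fun p => ⟨Finsupp.single 0 (2 * d - ((p.1 : ℕ) + 1)) + p.2.1.mapDomain Fin.succ, by
          constructor
          · rw [Fin.sum_univ_succ]
            simp only [Finsupp.add_apply, hmd0, hmds, Finsupp.single_eq_same]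
            have h1 := p.2.2.1
            have h2 := p.1.isLt
            simp only [Finsupp.single_apply, (Fin.succ_ne_zero _).symm, if_false, zero_add, h1]
            omega
          · obtain ⟨i, hi, hne⟩ := p.2.2.2
            refine ⟨i.succ, by simp; omega, ?_⟩
            rw [Finsupp.add_apply, hmds]
            omega⟩) (by
          rintro ⟨j, μ, hμ⟩ ⟨j', μ', hμ'⟩ h
          have h1 := congrArg Subtype.val h
          simp only at h1
          have h2 := DFunLike.congr_fun h1 0
          simp only [Finsupp.add_apply, hmd0, Finsupp.single_eq_same] at h2
          have hj := j.isLt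
          have hj' := j'.isLt
          obtain rfl : j = j' := Fin.ext (by omega)
          have h3 : μ = μ' := Finsupp.mapDomain_injective (Fin.succ_injective _)
            (add_left_cancel h1)
          subst h3
          rfl)
      convert hE using 1
      funext p
      exact (hG1c _ _).trans (hcoef _ (hmem p.1) _ (hmd0 _)).symm
    · apply IntermediateField.lift_injective K1
      rw [IntermediateField.lift_adjoin, IntermediateField.lift_top]
      congr 1
      rw [Set.image_iUnion]
      congr 1
      funext j
      rw [← Set.range_comp]
      congr 1
      funext m
      change algebraMap K1 K2 ((G1 j).coeff m) = _
      rw [← MvPolynomial.coeff_map, hG1]
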